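/- arXiv:2011.09753 — 5 statements merged into one kernel-verified Lean document; each statement's English description precedes it below -/
import Mathlib

section
/- For every history (O, po, wr) and operations o, o' ∈ O with (o,o') ∈ po, the stratified relations are monotone: hb[o]^i ⊆ hb[o']^i for every i ≥ 0. -/
inductive Label where
  | read (x : ℕ) (v : ℕ)
  | write (x : ℕ) (v : ℕ)
  deriving DecidableEq

structure History where
  Op : Type
  instFin : Fintype Op
  label : Op → Label
  po : Op → Op → Prop
  wr : Op → Op → Prop
  po_irrefl : ∀ a, ¬ po a a
  po_trans : ∀ a b c, po a b → po b c → po a c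
  wr_wf : ∀ w r, wr w r → ∃ x v, label w = Label.write x v ∧ label r = Label.read x v

namespace History

def co (h : History) : h.Op → h.Op → Prop :=
  Relation.TransGen (fun a b => h.po a b ∨ h.wr a b)

def coStar (h : History) (a b : h.Op) : Prop := a = b ∨ h.co a b

def poStar (h : History) (a b : h.Op) : Prop := a = b ∨ h.po a b

def isWriteOn (h : History) (a : h.Op) (x : ℕ) : Prop := ∃ v, h.label a = Label.write x v

def isReadOn (h : History) (a : h.Op) (x : ℕ) : Prop := ∃ v, h.label a = Label.read x v

inductive hb (h : History) (o : h.Op) : h.Op → h.Op → Prop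
  | base {o1 o2 : h.Op} (h1 : h.co o1 o2) (h2 : h.co o1 o) (h3 : h.coStar o2 o) :
      hb h o o1 o2
  | ww {w1 w2 r : h.Op} {x : ℕ} (hw1 : h.isWriteOn w1 x) (hw2 : h.isWriteOn w2 x)
      (hr : h.isReadOn r x) (hhb : hb h o w1 r) (hwr : h.wr w2 r) (hpo : h.poStar r o) :
      hb h o w1 w2
  | trans {a b c : h.Op} : hb h o a b → hb h o b c → hb h o a c

def hbStrat (h : History) (o : h.Op) : ℕ → h.Op → h.Op → Prop
  | 0 => fun o1 o2 => h.co o1 o2 ∧ h.co o1 o ∧ h.coStar o2 o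
  | (i+1) => fun w1 w2 => ∃ x r, h.isWriteOn w1 x ∧ h.isWriteOn w2 x ∧ h.isReadOn r x ∧
      Relation.TransGen (fun a b => ∃ j, ∃ _ : j < i + 1, hbStrat h o j a b) w1 r ∧
      h.wr w2 r ∧ h.poStar r o

def hbOmega (h : History) (o : h.Op) : h.Op → h.Op → Prop :=
  Relation.TransGen (fun a b => ∃ i, h.hbStrat o i a b)

def WriteHBInitReadWitness (h : History) (o w r : h.Op) : Prop :=
  ∃ x v, v ≠ 0 ∧ h.label w = Label.write x v ∧ h.label r = Label.read x 0 ∧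
    h.hb o w r ∧ h.poStar r o

inductive cf (h : History) : h.Op → h.Op → Prop
  | base {w w' r : h.Op} {x : ℕ} (hw : h.isWriteOn w x) (hw' : h.isWriteOn w' x)
      (hr : h.isReadOn r x) (hco : h.co w r) (hwr : h.wr w' r) : cf h w w'
  | trans {a b c : h.Op} : cf h a b → cf h b c → cf h a c

end History

namespace History

theorem co_of_co_of_po {h : History} {a o o' : h.Op} (hco : h.co a o) (hpo : h.po o o') :
    h.co a o' :=
  Relation.TransGen.tail hco (Or.inl hpo)

theorem coStar_of_coStar_of_po {h : History} {a o o' : h.Op} (hco : h.coStar a o)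
    (hpo : h.po o o') : h.coStar a o' := by
  rcases hco with rfl | hco
  · exact Or.inr (Relation.TransGen.single (Or.inl hpo))
  · exact Or.inr (co_of_co_of_po hco hpo)

theorem poStar_of_poStar_of_po {h : History} {a o o' : h.Op} (hpo₁ : h.poStar a o)
    (hpo₂ : h.po o o') : h.poStar a o' := by
  rcases hpo₁ with rfl | hpo₁
  · exact Or.inr hpo₂
  · exact Or.inr (h.po_trans _ _ _ hpo₁ hpo₂)

end History

theorem hbStrat_mono (h : History) (o o' : h.Op) (hpo : h.po o o') :
    ∀ (i : ℕ) (a b : h.Op), h.hbStrat o i a b → h.hbStrat o' i a b := by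
  intro i
  induction i using Nat.strong_induction_on with
  | _ i ih =>
    intro a b hab
    cases i with
    | zero =>
      rw [History.hbStrat] at hab ⊢
      exact ⟨hab.1, History.co_of_co_of_po hab.2.1 hpo,
        History.coStar_of_coStar_of_po hab.2.2 hpo⟩
    | succ i =>
      rw [History.hbStrat] at hab ⊢
      obtain ⟨x, r, ha, hb, hr, har, hwr, hro⟩ := hab
      refine ⟨x, r, ha, hb, hr, Relation.TransGen.mono ?_ a r har, hwr,
        History.poStar_of_poStar_of_po hro hpo⟩
      rintro c d ⟨j, hj, hcd⟩
      exact ⟨j, hj, ih j hj c d hcd⟩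
end

section
/- For every history (O, po, wr) and operations o, o' ∈ O, if (o,o') ∈ po then hb[o] ⊆ hb[o']. -/
theorem hb_mono (h : History) (o o' : h.Op) (hpo : h.po o o') :
    ∀ a b : h.Op, h.hb o a b → h.hb o' a b := by
  have hco : h.co o o' := .single (.inl hpo)
  intro a b hab
  induction hab with
  | base h1 h2 h3 =>
    refine .base h1 (h2.trans hco) (.inr ?_)
    rcases h3 with rfl | h3
    · exact hco
    · exact h3.trans hco
  | ww hw1 hw2 hr _ hwr hro ih =>
    refine .ww hw1 hw2 hr ih hwr (.inr ?_)
    rcases hro with rfl | hro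
    · exact hpo
    · exact h.po_trans _ _ _ hro hpo
  | trans _ _ ih1 ih2 => exact .trans ih1 ih2
end

section
/- For every history (O, po, wr) and operations o, o' ∈ O with (o,o') ∈ po*: if hb[o] is cyclic, i.e. there exists a ∈ O with (a,a) ∈ hb[o], then hb[o'] is cyclic as well. -/
namespace History

variable {h : History} {a b o o' : h.Op}

theorem co_of_co_of_poStar (hab : h.co a o) (hpo : h.poStar o o') : h.co a o' := by
  rcases hpo with rfl | hpo
  · exact hab
  · exact hab.tail (Or.inl hpo)

theorem coStar_of_coStar_of_poStar (hab : h.coStar a o) (hpo : h.poStar o o') :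
    h.coStar a o' := by
  rcases hab with rfl | hab
  · exact hpo.imp id fun hpo => Relation.TransGen.single (Or.inl hpo)
  · exact Or.inr (co_of_co_of_poStar hab hpo)

theorem poStar_trans (hab : h.poStar a o) (hpo : h.poStar o o') : h.poStar a o' := by
  rcases hab with rfl | hab
  · exact hpo
  · rcases hpo with rfl | hpo
    · exact Or.inr hab
    · exact Or.inr (h.po_trans _ _ _ hab hpo)

theorem hb_mono (hpo : h.poStar o o') (hab : h.hb o a b) : h.hb o' a b := by
  induction hab with
  | base h1 h2 h3 =>
    exact .base h1 (co_of_co_of_poStar h2 hpo) (coStar_of_coStar_of_poStar h3 hpo)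
  | ww hw1 hw2 hr _ hwr hro ih => exact .ww hw1 hw2 hr ih hwr (poStar_trans hro hpo)
  | trans _ _ ih1 ih2 => exact .trans ih1 ih2

end History

theorem hb_cycle_mono (h : History) (o o' : h.Op) (hpo : h.poStar o o')
    (hcyc : ∃ a : h.Op, h.hb o a a) : ∃ a : h.Op, h.hb o' a a := by
  obtain ⟨a, ha⟩ := hcyc
  exact ⟨a, History.hb_mono hpo ha⟩
end

section
/- For every history (O, po, wr) and operations o1, o2 ∈ O with (o1,o2) ∈ po: if there is a WriteHBInitRead witness for o1, i.e. a read operation r = read(x,0) and a write operation w on x with value v ≠ 0 such that (w,r) ∈ hb[o1] and (r,o1) ∈ po*, then the same pair (w,r) is a WriteHBInitRead witness for o2, i.e. (w,r) ∈ hb[o2] and (r,o2) ∈ po*. -/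
namespace History

theorem poStar.trans_po {h : History} {a b c : h.Op} (hab : h.poStar a b) (hbc : h.po b c) :
    h.poStar a c := by
  rcases hab with rfl | hab
  · exact Or.inr hbc
  · exact Or.inr (h.po_trans _ _ _ hab hbc)

theorem coStar.trans_po {h : History} {a b c : h.Op} (hab : h.coStar a b) (hbc : h.po b c) :
    h.co a c := by
  rcases hab with rfl | hab
  · exact .single (Or.inl hbc)
  · exact .tail hab (Or.inl hbc)

theorem hb.mono_po {h : History} {o o' a b : h.Op} (hpo : h.po o o') (hab : h.hb o a b) :
    h.hb o' a b := by
  induction hab with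
  | base h1 h2 h3 =>
    exact .base h1 (coStar.trans_po (Or.inr h2) hpo) (Or.inr (h3.trans_po hpo))
  | ww hw1 hw2 hr _ hwr hp ih => exact .ww hw1 hw2 hr ih hwr (hp.trans_po hpo)
  | trans _ _ ih₁ ih₂ => exact .trans ih₁ ih₂

end History

theorem writeHBInitRead_witness_mono (h : History) (o1 o2 : h.Op) (hpo : h.po o1 o2)
    (w r : h.Op) (x v : ℕ) (hv : v ≠ 0)
    (hw : h.label w = Label.write x v) (hr : h.label r = Label.read x 0)
    (hhb : h.hb o1 w r) (hrp : h.poStar r o1) :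
    h.hb o2 w r ∧ h.poStar r o2 :=
  ⟨hhb.mono_po hpo, hrp.trans_po hpo⟩
end

section
/- Let (O, po, wr) be a history with O finite. Then the following are equivalent: (a) for every operation o ∈ O, hb[o] is acyclic and there is no WriteHBInitRead witness for o; (b) for every po-maximal operation o ∈ O (i.e., no o' with (o,o') ∈ po), hb[o] is acyclic and there is no WriteHBInitRead witness for o. -/
namespace History

variable {h : History}

theorem co_of_co_of_po_s9 {a b c : h.Op} (hab : h.co a b) (hbc : h.po b c) : h.co a c :=
  Relation.TransGen.tail hab (Or.inl hbc)

theorem coStar_of_coStar_of_po_s9 {a b c : h.Op} (hab : h.coStar a b) (hbc : h.po b c) :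
    h.coStar a c := by
  rcases hab with rfl | hab
  · exact Or.inr (Relation.TransGen.single (Or.inl hbc))
  · exact Or.inr (co_of_co_of_po_s9 hab hbc)

theorem poStar_trans_s9 {a b c : h.Op} (hab : h.poStar a b) (hbc : h.poStar b c) :
    h.poStar a c := by
  rcases hab with rfl | hab
  · exact hbc
  · rcases hbc with rfl | hbc
    · exact Or.inr hab
    · exact Or.inr (h.po_trans _ _ _ hab hbc)

theorem hb_mono_of_po {o o' a b : h.Op} (hpo : h.po o o') (hab : h.hb o a b) :
    h.hb o' a b := by
  induction hab with
  | base h1 h2 h3 => exact .base h1 (co_of_co_of_po_s9 h2 hpo) (coStar_of_coStar_of_po_s9 h3 hpo)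
  | ww hw1 hw2 hr _ hwr hro ih => exact .ww hw1 hw2 hr ih hwr (poStar_trans_s9 hro (Or.inr hpo))
  | trans _ _ ih1 ih2 => exact .trans ih1 ih2

theorem hb_mono_of_poStar {o o' a b : h.Op} (hpo : h.poStar o o') (hab : h.hb o a b) :
    h.hb o' a b := by
  rcases hpo with rfl | hpo
  · exact hab
  · exact hb_mono_of_po hpo hab

theorem WriteHBInitReadWitness.mono {o o' w r : h.Op} (hpo : h.poStar o o')
    (hw : h.WriteHBInitReadWitness o w r) : h.WriteHBInitReadWitness o' w r := by
  obtain ⟨x, v, hv, hlw, hlr, hwr, hro⟩ := hw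
  exact ⟨x, v, hv, hlw, hlr, hb_mono_of_poStar hpo hwr, poStar_trans_s9 hro hpo⟩

theorem exists_poStar_maximal (h : History) (o : h.Op) :
    ∃ m, h.poStar o m ∧ ∀ o', ¬ h.po m o' := by
  have := h.instFin
  have : IsTrans h.Op (Function.swap h.po) := ⟨fun _ _ _ hab hbc => h.po_trans _ _ _ hbc hab⟩
  have : Std.Irrefl (Function.swap h.po) := ⟨h.po_irrefl⟩
  obtain ⟨m, hm, hmax⟩ := (Finite.wellFounded_of_trans_of_irrefl (Function.swap h.po)).has_min
    {m | h.poStar o m} ⟨o, Or.inl rfl⟩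
  exact ⟨m, hm, fun o' ho' => hmax o' (poStar_trans_s9 hm (Or.inr ho')) ho'⟩

end History

theorem cm_check_po_maximal_suffices (h : History) :
    ((∀ o : h.Op, (∀ a : h.Op, ¬ h.hb o a a) ∧
        ∀ w r : h.Op, ¬ h.WriteHBInitReadWitness o w r) ↔
      (∀ o : h.Op, (∀ o' : h.Op, ¬ h.po o o') →
        ((∀ a : h.Op, ¬ h.hb o a a) ∧
          ∀ w r : h.Op, ¬ h.WriteHBInitReadWitness o w r))) := by
  refine ⟨fun H o _ => H o, fun H o => ?_⟩
  obtain ⟨m, hom, hmax⟩ := h.exists_poStar_maximal o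
  obtain ⟨hacyc, hinit⟩ := H m hmax
  exact ⟨fun a ha => hacyc a (History.hb_mono_of_poStar hom ha),
    fun w r hw => hinit w r (hw.mono hom)⟩
end
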